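/- Fix m ≥ 1 and n ≥ 1. For all a^1, …, a^n ∈ A(m) we have E_n(a^1, …, a^n) ≥ 0. -/

import Mathlib

/-- `a` belongs to `A(m)`: integer sequences with `m ≥ a_1 ≥ ⋯ ≥ a_m ≥ 0`. -/
def memA (m : ℕ) (a : Fin m → ℤ) : Prop :=
  (∀ j, 0 ≤ a j) ∧ (∀ j, a j ≤ (m : ℤ)) ∧ Antitone a

/-- Expectation of a sequence: `E(a) = (a_1 + ⋯ + a_m)/m²`. -/
noncomputable def Eseq {m : ℕ} (a : Fin m → ℤ) : ℝ :=
  (∑ j, (a j : ℝ)) / (m : ℝ) ^ 2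

/-- Pointwise product of sequences: `(ab)_j = min(a_j, b_j)`. -/
def prodMin {m : ℕ} (a b : Fin m → ℤ) : Fin m → ℤ := fun j => min (a j) (b j)

/-- `a⁺ = a^{+,i}`: agrees with `a` except `(a⁺)_{i+1} = a_i` (here `i` is 0-based,
so positions `i, i+1` are the 1-based positions `i+1, i+2`). -/
def aPlus {m : ℕ} (a : Fin m → ℤ) (i : ℕ) (hi : i + 1 < m) : Fin m → ℤ :=
  Function.update a ⟨i + 1, hi⟩ (a ⟨i, by omega⟩)

/-- `a⁻ = a^{−,i}`: agrees with `a` except `(a⁻)_i = a_{i+1}`. -/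
def aMinus {m : ℕ} (a : Fin m → ℤ) (i : ℕ) (hi : i + 1 < m) : Fin m → ℤ :=
  Function.update a ⟨i, by omega⟩ (a ⟨i + 1, hi⟩)

/-- `a⋆ = a^{⋆,i}`: agrees with `a` except `(a⋆)_{i+1} = a_{i+1} + 1`. -/
def aStar {m : ℕ} (a : Fin m → ℤ) (i : ℕ) (hi : i + 1 < m) : Fin m → ℤ :=
  Function.update a ⟨i + 1, hi⟩ (a ⟨i + 1, hi⟩ + 1)

/-- The orbits (cycles, counting fixed points as 1-cycles) of a permutation `σ`
of a finite index type, as a finset of finsets. -/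
def permOrbits {ι : Type*} [Fintype ι] [DecidableEq ι] (σ : Equiv.Perm ι) : Finset (Finset ι) :=
  Finset.univ.image fun x => Finset.univ.filter fun y => σ.SameCycle x y

/-- The pointwise-min product `∏_{i ∈ O} aⁱ` of a family of sequences over a finset `O`.
(The fold starts at `m`; since all entries of sequences in `A(m)` are `≤ m` and orbits are
nonempty, this is the entrywise minimum over `O`.) -/
def seqProd {m : ℕ} {ι : Type*} (a : ι → Fin m → ℤ) (O : Finset ι) : Fin m → ℤ :=
  fun j => O.fold min (m : ℤ) fun i => a i j

/-- Sahi's functional `E_n(a¹,…,aⁿ) = ∑_{σ ∈ S_n} (−1)^{C_σ−1} ∏_{O orbit of σ} E(∏_{i∈O} aⁱ)`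
for sequences, with pointwise-min products. -/
noncomputable def EnSeq {m : ℕ} {ι : Type*} [Fintype ι] [DecidableEq ι]
    (a : ι → Fin m → ℤ) : ℝ :=
  ∑ σ : Equiv.Perm ι, (-1 : ℝ) ^ ((permOrbits σ).card - 1) *
    ∏ O ∈ permOrbits σ, Eseq (seqProd a O)

/-- The sum over permutations `σ` of the products of `-L (∏ i ∈ O, f i)` over the orbits `O`
of `σ`. -/
noncomputable def cycleSum {A : Type*} [CommMonoid A] {n : ℕ} (L : A → ℝ) (f : Fin n → A) : ℝ :=
  ∑ σ : Equiv.Perm (Fin n), ∏ O ∈ permOrbits σ, -L (∏ i ∈ O, f i)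

section Orbits

variable {A : Type*} [CommMonoid A]

/-- If `π` is a surjection identifying the orbit relations of `σ` and `τ`, then orbit products
for `σ` are orbit products for `τ` of the products over the fibres of `π`. -/
theorem prod_permOrbits_of_surjective {ι κ : Type*} [Fintype ι] [DecidableEq ι] [Fintype κ]
    [DecidableEq κ] {σ : Equiv.Perm ι} {τ : Equiv.Perm κ} {π : ι → κ}
    (hπ : Function.Surjective π) (h : ∀ x y, σ.SameCycle x y ↔ τ.SameCycle (π x) (π y))
    (H : A → ℝ) (f : ι → A) :
    ∏ O ∈ permOrbits σ, H (∏ i ∈ O, f i) =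
      ∏ O ∈ permOrbits τ, H (∏ k ∈ O, ∏ i with π i = k, f i) := by
  have himage : permOrbits σ =
      (permOrbits τ).image fun O => Finset.univ.filter fun i => π i ∈ O := by
    ext O
    simp only [permOrbits, Finset.mem_image, Finset.mem_univ, true_and, exists_exists_eq_and,
      Finset.mem_filter, h]
    constructor
    · rintro ⟨x, rfl⟩
      exact ⟨π x, rfl⟩
    · rintro ⟨k, rfl⟩
      obtain ⟨x, rfl⟩ := hπ k
      exact ⟨x, rfl⟩
  rw [himage, Finset.prod_image]
  · refine Finset.prod_congr rfl fun O _ => ?_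
    congr 1
    rw [← Finset.prod_fiberwise_of_maps_to (s := Finset.univ.filter fun i => π i ∈ O) (t := O)
      (g := π) (fun i hi => (Finset.mem_filter.1 hi).2)]
    refine Finset.prod_congr rfl fun k hk => ?_
    refine Finset.prod_congr ?_ fun _ _ => rfl
    ext i
    simp only [Finset.mem_filter, Finset.mem_univ, true_and]
    constructor
    · exact fun hi => hi.2
    · rintro rfl
      exact ⟨hk, rfl⟩
  · intro O₁ _ O₂ _ hO
    ext k
    obtain ⟨x, rfl⟩ := hπ k
    simpa using congrArg (fun S => x ∈ S) hO

theorem cycleSum_comp_perm {n : ℕ} (L : A → ℝ) (f : Fin n → A) (e : Equiv.Perm (Fin n)) :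
    cycleSum L (f ∘ e) = cycleSum L f := by
  unfold cycleSum
  refine Fintype.sum_equiv (MulAut.conj e).toEquiv _ _ fun σ => ?_
  rw [prod_permOrbits_of_surjective (τ := (MulAut.conj e).toEquiv σ) e.surjective ?_ fun a => -L a]
  · refine Finset.prod_congr rfl fun O _ => ?_
    congr 2
    refine Finset.prod_congr rfl fun k _ => ?_
    rw [Finset.prod_eq_single (e.symm k)] <;> simp +contextual [Equiv.eq_symm_apply]
  · intro x y
    simp [Equiv.Perm.sameCycle_conj]

theorem sameCycle_map_of_step {ι κ : Type*} [Finite ι] {σ : Equiv.Perm ι} {τ : Equiv.Perm κ}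
    {π : ι → κ} (h : ∀ x, τ.SameCycle (π x) (π (σ x))) {x y : ι} (hxy : σ.SameCycle x y) :
    τ.SameCycle (π x) (π y) := by
  obtain ⟨k, rfl⟩ := hxy.exists_nat_pow_eq
  clear hxy
  induction k with
  | zero => exact Equiv.Perm.SameCycle.refl _ _
  | succ k ih =>
    rw [pow_succ', Equiv.Perm.mul_apply]
    exact ih.trans (h _)

theorem permOrbits_decomposeFin_zero {n : ℕ} (τ : Equiv.Perm (Fin n)) :
    permOrbits (Equiv.Perm.decomposeFin.symm (0, τ)) =
      insert {0} ((permOrbits τ).image fun O => O.map (Fin.succEmb n)) := by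
  set σ := Equiv.Perm.decomposeFin.symm (0, τ) with hσ
  have h0 : σ 0 = 0 := by simp [hσ]
  have hs : ∀ i : Fin n, σ i.succ = (τ i).succ := by simp [hσ]
  have hzero : ∀ y, σ.SameCycle 0 y ↔ y = 0 := fun y => by
    constructor
    · exact fun h => ((h.eq_of_left h0).symm)
    · rintro rfl
      exact Equiv.Perm.SameCycle.refl _ _
  have hsucc : ∀ i j : Fin n, σ.SameCycle i.succ j.succ ↔ τ.SameCycle i j := fun i j => by
    constructor
    · intro h
      have := sameCycle_map_of_step (σ := σ) (τ := τ)
        (π := fun x : Fin (n + 1) => Fin.cases i id x) (fun x => ?_) h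
      · simpa using this
      · cases x using Fin.cases with
        | zero => simp [h0, Equiv.Perm.SameCycle.refl]
        | succ k => simp [hs, Equiv.Perm.SameCycle.refl]
    · refine sameCycle_map_of_step (π := Fin.succ) fun x => ?_
      rw [← hs]
      simp [Equiv.Perm.SameCycle.refl]
  ext O
  simp only [permOrbits, Finset.mem_image, Finset.mem_univ, true_and, Finset.mem_insert,
    exists_exists_eq_and]
  rw [Fin.exists_fin_succ]
  refine or_congr ?_ (exists_congr fun i => ?_)
  · rw [eq_comm]
    simp [hzero, Finset.filter_eq']
  · have : (Finset.univ.filter fun y => σ.SameCycle i.succ y) =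
        (Finset.univ.filter fun y => τ.SameCycle i y).map (Fin.succEmb n) := by
      ext y
      cases y using Fin.cases with
      | zero =>
        simp only [Finset.mem_filter, Finset.mem_univ, true_and, Finset.mem_map,
          Fin.coe_succEmb, Fin.succ_ne_zero, and_false, exists_false, iff_false]
        intro h
        exact Fin.succ_ne_zero _ ((hzero _).1 h.symm)
      | succ k => simp [hsucc]
    rw [this]

theorem sameCycle_decomposeFin_succ {n : ℕ} (j : Fin n) (τ : Equiv.Perm (Fin n))
    (x y : Fin (n + 1)) :
    (Equiv.Perm.decomposeFin.symm (j.succ, τ)).SameCycle x y ↔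
      τ.SameCycle (Fin.cases j id x : Fin n) (Fin.cases j id y : Fin n) := by
  set σ := Equiv.Perm.decomposeFin.symm (j.succ, τ) with hσ
  have h0 : σ 0 = j.succ := by simp [hσ]
  have hs : ∀ i : Fin n, σ i.succ = Equiv.swap 0 j.succ (τ i).succ := by simp [hσ]
  have hlift : ∀ z : Fin (n + 1), σ.SameCycle z (Fin.cases j id z : Fin n).succ := fun z => by
    cases z using Fin.cases with
    | zero => exact ⟨1, by simpa using h0⟩
    | succ k => exact Equiv.Perm.SameCycle.refl _ _
  constructor
  · refine sameCycle_map_of_step (π := fun z : Fin (n + 1) => (Fin.cases j id z : Fin n))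
      fun z => ?_
    cases z using Fin.cases with
    | zero => simp [h0, Equiv.Perm.SameCycle.refl]
    | succ k =>
      rw [hs]
      by_cases hk : τ k = j
      · rw [hk, Equiv.swap_apply_right]
        simp [← hk, Equiv.Perm.SameCycle.refl]
      · rw [Equiv.swap_apply_of_ne_of_ne (Fin.succ_ne_zero _) (by simpa using hk)]
        simp [Equiv.Perm.SameCycle.refl]
  · intro h
    refine (hlift x).trans (Equiv.Perm.SameCycle.trans ?_ (hlift y).symm)
    refine sameCycle_map_of_step (π := Fin.succ) (fun k => ?_) h
    by_cases hk : τ k = j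
    · refine ⟨2, ?_⟩
      change σ (σ k.succ) = _
      rw [hs, hk, Equiv.swap_apply_right, h0]
    · refine ⟨1, ?_⟩
      rw [zpow_one, hs, Equiv.swap_apply_of_ne_of_ne (Fin.succ_ne_zero _) (by simpa using hk)]

/-- Removing the index `0` from a permutation: it is either a fixed point or follows some other
index in its orbit. -/
theorem cycleSum_succ {n : ℕ} (L : A → ℝ) (f : Fin (n + 1) → A) :
    cycleSum L f = -L (f 0) * cycleSum L (f ∘ Fin.succ) +
      ∑ j, cycleSum L (Function.update (f ∘ Fin.succ) j (f j.succ * f 0)) := by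
  unfold cycleSum
  rw [← Equiv.Perm.decomposeFin.symm.sum_comp, Fintype.sum_prod_type, Fin.sum_univ_succ]
  congr 1
  · rw [Finset.mul_sum]
    refine Finset.sum_congr rfl fun τ _ => ?_
    rw [permOrbits_decomposeFin_zero, Finset.prod_insert, Finset.prod_image]
    · simp
    · exact fun _ _ _ _ h => Finset.map_injective _ h
    · simp only [Finset.mem_image, not_exists, not_and]
      intro O _ hO
      have : (0 : Fin (n + 1)) ∈ O.map (Fin.succEmb n) := by simp [hO]
      simp at this
  · refine Finset.sum_congr rfl fun j _ => Finset.sum_congr rfl fun τ _ => ?_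
    rw [prod_permOrbits_of_surjective (τ := τ) (fun k => ⟨k.succ, by simp⟩)
      (sameCycle_decomposeFin_succ j τ) fun a => -L a]
    refine Finset.prod_congr rfl fun O _ => ?_
    congr 2
    refine Finset.prod_congr rfl fun k _ => ?_
    rw [Finset.prod_filter, Fin.prod_univ_succ]
    have hsingle : (∏ i : Fin n, if (Fin.cases j id i.succ : Fin n) = k then f i.succ else 1) =
        f k.succ := by
      rw [Finset.prod_eq_single k] <;> simp +contextual
    rw [hsingle]
    by_cases hk : k = j
    · subst hk
      simp [mul_comm]
    · simp [hk, Ne.symm hk]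

end Orbits

section Functional

variable {Ω : Type*}

theorem cycleSum_cons {A : Type*} [CommMonoid A] {n : ℕ} (L : A → ℝ) (p : A) (F : Fin n → A) :
    cycleSum L (Fin.cons p F : Fin (n + 1) → A) = -L p * cycleSum L F +
      ∑ j, cycleSum L (Function.update F j (F j * p)) := by
  rw [cycleSum_succ]
  rfl

theorem cycleSum_update {A : Type*} [CommMonoid A] {n : ℕ} (L : A → ℝ) (f : Fin (n + 1) → A)
    (l : Fin (n + 1)) (g : A) :
    cycleSum L (Function.update f l g) =
      cycleSum L (Fin.cons g fun i : Fin n => f (Equiv.swap 0 l i.succ) : Fin (n + 1) → A) := by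
  rw [← cycleSum_comp_perm L _ (Equiv.swap 0 l)]
  congr 1
  funext i
  cases i using Fin.cases with
  | zero => simp
  | succ i =>
    have : Equiv.swap 0 l i.succ ≠ l := fun h =>
      Fin.succ_ne_zero i ((Equiv.swap 0 l).injective (h.trans (Equiv.swap_apply_left 0 l).symm))
    simp [this]

theorem cycleSum_cons_cons {A : Type*} [CommMonoid A] {n : ℕ} (L : A → ℝ) (p q : A)
    (F : Fin n → A) :
    cycleSum L (Fin.cons p (Fin.cons q F : Fin (n + 1) → A) : Fin (n + 2) → A) =
      cycleSum L (Fin.cons q (Fin.cons p F : Fin (n + 1) → A) : Fin (n + 2) → A) := by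
  rw [← cycleSum_comp_perm L _ (Equiv.swap 0 1)]
  congr 1
  funext i
  cases i using Fin.cases with
  | zero => simp
  | succ i =>
    cases i using Fin.cases with
    | zero => simp
    | succ i =>
      have h1 : i.succ.succ ≠ 1 := fun h => by simp [Fin.ext_iff] at h
      simp [Equiv.swap_apply_of_ne_of_ne (Fin.succ_ne_zero _) h1]

theorem cycleSum_fin_zero {A : Type*} [CommMonoid A] (L : A → ℝ) (f : Fin 0 → A) :
    cycleSum L f = 1 := by
  simp [cycleSum, permOrbits]

theorem cycleSum_update_linear {n : ℕ} (L : (Ω → ℝ) →ₗ[ℝ] ℝ) (f : Fin n → Ω → ℝ) (l : Fin n)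
    (c d : ℝ) (g h : Ω → ℝ) :
    cycleSum L (Function.update f l (c • g + d • h)) =
      c * cycleSum L (Function.update f l g) + d * cycleSum L (Function.update f l h) := by
  induction n generalizing g h with
  | zero => exact l.elim0
  | succ n ih =>
    simp only [cycleSum_update, cycleSum_cons, mul_add, mul_smul_comm, ih, map_add, map_smul,
      Finset.sum_add_distrib, ← Finset.mul_sum, smul_eq_mul]
    ring

theorem cycleSum_update_add {n : ℕ} (L : (Ω → ℝ) →ₗ[ℝ] ℝ) (f : Fin n → Ω → ℝ) (l : Fin n)
    (g h : Ω → ℝ) :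
    cycleSum L (Function.update f l (g + h)) =
      cycleSum L (Function.update f l g) + cycleSum L (Function.update f l h) := by
  simpa using cycleSum_update_linear L f l 1 1 g h

theorem cycleSum_cons_smul {n : ℕ} (L : (Ω → ℝ) →ₗ[ℝ] ℝ) (F : Fin n → Ω → ℝ) (c : ℝ)
    (g : Ω → ℝ) :
    cycleSum L (Fin.cons (c • g) F : Fin (n + 1) → Ω → ℝ) =
      c * cycleSum L (Fin.cons g F : Fin (n + 1) → Ω → ℝ) := by
  simpa using cycleSum_update_linear L (Fin.cons g F : Fin (n + 1) → Ω → ℝ) 0 c 0 g g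

/-- A point mass in one slot amounts to subtracting the evaluation at that point from the
functional. -/
theorem cycleSum_cons_single [DecidableEq Ω] {n : ℕ} (L : (Ω → ℝ) →ₗ[ℝ] ℝ) (x : Ω)
    (F : Fin n → Ω → ℝ) :
    cycleSum L (Fin.cons (Pi.single x 1) F : Fin (n + 1) → Ω → ℝ) =
      -L (Pi.single x 1) * cycleSum (L - LinearMap.proj x : (Ω → ℝ) →ₗ[ℝ] ℝ) F := by
  induction n with
  | zero => simp [cycleSum_cons, cycleSum_fin_zero]
  | succ n ih =>
    obtain ⟨p, F, rfl⟩ : ∃ p F', F = Fin.cons p F' := ⟨F 0, Fin.tail F, (Fin.cons_self_tail F).symm⟩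
    have hp : (Pi.single x 1 : Ω → ℝ) * p = p x • Pi.single x 1 := by
      funext y
      by_cases hy : y = x
      · subst hy
        simp
      · simp [hy]
    rw [cycleSum_cons_cons, cycleSum_cons, Fin.sum_univ_succ,
      cycleSum_cons (L - LinearMap.proj x : (Ω → ℝ) →ₗ[ℝ] ℝ)]
    simp only [Fin.cons_zero, Fin.cons_succ, Fin.update_cons_zero, ← Fin.cons_update, hp,
      cycleSum_cons_smul, ih, ← Finset.mul_sum]
    simp only [LinearMap.sub_apply, LinearMap.proj_apply]
    ring

theorem cycleSum_sub_proj_of_eq_zero {n : ℕ} (L : (Ω → ℝ) →ₗ[ℝ] ℝ) (x : Ω)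
    (F : Fin n → Ω → ℝ) (hF : ∀ i, F i x = 0) :
    cycleSum (L - LinearMap.proj x : (Ω → ℝ) →ₗ[ℝ] ℝ) F = cycleSum L F := by
  induction n with
  | zero => simp [cycleSum_fin_zero]
  | succ n ih =>
    rw [cycleSum_succ, cycleSum_succ, ih (F ∘ Fin.succ) fun i => hF _]
    simp only [LinearMap.sub_apply, LinearMap.proj_apply, hF, sub_zero]
    congr 1
    refine Finset.sum_congr rfl fun j _ => ih _ fun i => ?_
    by_cases hi : i = j
    · subst hi
      simp [hF]
    · simp [hi, hF]

/-- If `cycleSum L` is nonpositive on nonempty families from a multiplicatively closed class of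
functions, then so is `cycleSum (L - eval x)` on families with a member vanishing at `x`. -/
theorem cycleSum_sub_proj_nonpos {n : ℕ} {L : (Ω → ℝ) →ₗ[ℝ] ℝ} {x : Ω} {C : Set (Ω → ℝ)}
    (hmul : ∀ f ∈ C, ∀ g ∈ C, f * g ∈ C) (hval : ∀ f ∈ C, f x = 0 ∨ f x = 1)
    (hL : ∀ f ∈ C, L f ≤ 1)
    (hneg : ∀ k ≤ n, 0 < k → ∀ G : Fin k → Ω → ℝ, (∀ i, G i ∈ C) → cycleSum L G ≤ 0)
    (F : Fin n → Ω → ℝ) (hF : ∀ i, F i ∈ C) (hx : ∃ i, F i x = 0) :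
    cycleSum (L - LinearMap.proj x : (Ω → ℝ) →ₗ[ℝ] ℝ) F ≤ 0 := by
  induction n with
  | zero => exact hx.choose.elim0
  | succ n ih =>
    by_cases hall : ∀ i, F i x = 0
    · rw [cycleSum_sub_proj_of_eq_zero L x F hall]
      exact hneg _ le_rfl n.succ_pos F hF
    · push Not at hall
      obtain ⟨p, hp⟩ := hall
      obtain ⟨q, hq⟩ := hx
      have hp1 : F p x = 1 := (hval _ (hF p)).resolve_left hp
      rw [← cycleSum_comp_perm _ F (Equiv.swap 0 p), cycleSum_succ]
      set G : Fin (n + 1) → Ω → ℝ := F ∘ Equiv.swap 0 p with hG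
      have hGC : ∀ i, G i ∈ C := fun i => hF _
      have hG0 : G 0 = F p := by simp [hG]
      obtain ⟨r, hr⟩ : ∃ r : Fin n, G r.succ x = 0 := by
        have hne : Equiv.swap 0 p q ≠ 0 := fun h => by
          have : q = p := by
            rw [Equiv.swap_apply_eq_iff, Equiv.swap_apply_left] at h
            exact h
          exact hp (this ▸ hq)
        obtain ⟨r, hr⟩ := Fin.exists_succ_eq.2 hne
        exact ⟨r, by simp [hG, hr, hq]⟩
      have ih' := ih fun k hk => hneg k (hk.trans n.le_succ)
      have hcoef : 0 ≤ -(L - LinearMap.proj x : (Ω → ℝ) →ₗ[ℝ] ℝ) (G 0) := by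
        have := hL _ (hGC 0)
        simp only [LinearMap.sub_apply, LinearMap.proj_apply]
        rw [hG0, hp1, ← hG0]
        linarith
      refine add_nonpos (mul_nonpos_of_nonneg_of_nonpos hcoef
        (ih' _ (fun i => hGC _) ⟨r, hr⟩)) (Finset.sum_nonpos fun j _ => ih' _ (fun i => ?_) ⟨r, ?_⟩)
      · by_cases hi : i = j
        · subst hi
          simpa using hmul _ (hGC _) _ (hGC _)
        · simpa [hi] using hGC _
      · by_cases hi : r = j
        · subst hi
          simp [hr]
        · simp [hi, hr]

theorem cycleSum_comp_of_invariant {n : ℕ} (L : (Ω → ℝ) →ₗ[ℝ] ℝ) (s : Ω → Ω)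
    (hs : ∀ f, L (f ∘ s) = L f) (F : Fin n → Ω → ℝ) :
    cycleSum L (fun i => F i ∘ s) = cycleSum L F := by
  unfold cycleSum
  refine Finset.sum_congr rfl fun σ _ => Finset.prod_congr rfl fun O _ => ?_
  rw [← hs (∏ i ∈ O, F i)]
  congr 2
  funext y
  simp [Finset.prod_apply]

end Functional

section Diagrams

variable {m : ℕ}

/-- The indicator function of the diagram whose column `j` has height `a j`. -/
def diagramInd (a : Fin m → ℤ) : Fin m × Fin m → ℝ :=
  fun x => if (x.2 : ℤ) < a x.1 then 1 else 0

/-- The mean of a function on the `m × m` grid. -/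
noncomputable def gridMean (m : ℕ) : (Fin m × Fin m → ℝ) →ₗ[ℝ] ℝ :=
  ((m : ℝ) ^ 2)⁻¹ • ∑ x, LinearMap.proj x

theorem gridMean_apply (f : Fin m × Fin m → ℝ) :
    gridMean m f = (∑ x, f x) / (m : ℝ) ^ 2 := by
  simp [gridMean, LinearMap.sum_apply, div_eq_inv_mul]

theorem gridMean_comp_equiv (e : Fin m × Fin m ≃ Fin m × Fin m) (f : Fin m × Fin m → ℝ) :
    gridMean m (f ∘ e) = gridMean m f := by
  simp only [gridMean_apply, Function.comp_apply, Equiv.sum_comp e f]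

theorem diagramInd_eq_zero_or_one (a : Fin m → ℤ) (x : Fin m × Fin m) :
    diagramInd a x = 0 ∨ diagramInd a x = 1 := by
  unfold diagramInd
  split_ifs <;> simp

theorem diagramInd_mul (a b : Fin m → ℤ) :
    diagramInd a * diagramInd b = diagramInd (prodMin a b) := by
  funext x
  simp only [Pi.mul_apply, diagramInd, prodMin, lt_min_iff]
  split_ifs <;> simp_all

theorem memA.prodMin {a b : Fin m → ℤ} (ha : memA m a) (hb : memA m b) :
    memA m (prodMin a b) :=
  ⟨fun j => le_min (ha.1 j) (hb.1 j), fun j => (min_le_left _ _).trans (ha.2.1 j),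
    fun _ _ h => min_le_min (ha.2.2 h) (hb.2.2 h)⟩

theorem gridMean_diagramInd {a : Fin m → ℤ} (h0 : ∀ j, 0 ≤ a j) (hm : ∀ j, a j ≤ m) :
    gridMean m (diagramInd a) = Eseq a := by
  rw [gridMean_apply, Eseq, Fintype.sum_prod_type]
  congr 1
  refine Finset.sum_congr rfl fun j _ => ?_
  obtain ⟨k, hk⟩ := Int.eq_ofNat_of_zero_le (h0 j)
  have hkm : k ≤ m := by have := hm j; omega
  simp only [diagramInd, hk]
  rw [Fin.sum_univ_eq_sum_range (fun y => if (y : ℤ) < (k : ℤ) then (1 : ℝ) else 0) m,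
    ← Finset.sum_filter, Finset.sum_const]
  have : (Finset.range m).filter (fun y : ℕ => (y : ℤ) < (k : ℤ)) = Finset.range k := by
    ext y
    simp only [Finset.mem_filter, Finset.mem_range]
    omega
  rw [this]
  simp

theorem gridMean_le_one {f : Fin m × Fin m → ℝ} (hf : ∀ x, f x ≤ 1) : gridMean m f ≤ 1 := by
  rw [gridMean_apply]
  refine div_le_one_of_le₀ ((Finset.sum_le_sum fun x _ => hf x).trans ?_) (by positivity)
  simp [sq]

theorem gridMean_nonneg {f : Fin m × Fin m → ℝ} (hf : ∀ x, 0 ≤ f x) : 0 ≤ gridMean m f := by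
  rw [gridMean_apply]
  exact div_nonneg (Finset.sum_nonneg fun x _ => hf x) (by positivity)

theorem diagramInd_nonneg (a : Fin m → ℤ) (x : Fin m × Fin m) : 0 ≤ diagramInd a x := by
  rcases diagramInd_eq_zero_or_one a x with h | h <;> simp [h]

theorem diagramInd_le_one (a : Fin m → ℤ) (x : Fin m × Fin m) : diagramInd a x ≤ 1 := by
  rcases diagramInd_eq_zero_or_one a x with h | h <;> simp [h]

theorem diagramInd_seqProd {ι : Type*} [DecidableEq ι] (a : ι → Fin m → ℤ) (O : Finset ι) :
    diagramInd (seqProd a O) = ∏ i ∈ O, diagramInd (a i) := by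
  induction O using Finset.induction_on with
  | empty =>
    funext x
    simp [diagramInd, seqProd]
  | insert i O hi ih =>
    rw [Finset.prod_insert hi, ← ih, diagramInd_mul]
    congr 1
    funext j
    simp [seqProd, prodMin, hi]

theorem EnSeq_eq_neg_cycleSum {n : ℕ} (hn : 1 ≤ n) {a : Fin n → Fin m → ℤ}
    (ha : ∀ l, memA m (a l)) :
    EnSeq a = -cycleSum (gridMean m) fun l => diagramInd (a l) := by
  rw [EnSeq, cycleSum, ← Finset.sum_neg_distrib]
  refine Finset.sum_congr rfl fun σ _ => ?_
  have hE : ∀ O : Finset (Fin n),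
      gridMean m (∏ i ∈ O, diagramInd (a i)) = Eseq (seqProd a O) := fun O => by
    rw [← diagramInd_seqProd, gridMean_diagramInd]
    · exact fun j => (Finset.le_fold_min _).2 ⟨by positivity, fun i _ => (ha i).1 j⟩
    · exact fun j => (Finset.fold_min_le _).2 (Or.inl le_rfl)
  simp only [hE, Finset.prod_neg]
  have hcard : 0 < (permOrbits σ).card :=
    Finset.card_pos.2 ⟨_, Finset.mem_image_of_mem _ (Finset.mem_univ (⟨0, hn⟩ : Fin n))⟩
  obtain ⟨c, hc⟩ := Nat.exists_eq_succ_of_ne_zero hcard.ne'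
  rw [hc]
  simp [pow_succ]

theorem diagramInd_update_add_one {a : Fin m → ℤ} {j y : Fin m} (hy : (y : ℤ) = a j) :
    diagramInd (Function.update a j (a j + 1)) = diagramInd a + Pi.single (j, y) 1 := by
  funext ⟨i, z⟩
  by_cases hi : i = j
  · subst hi
    by_cases hz : z = y
    · subst hz
      simp [diagramInd, hy]
    · have : (z : ℤ) ≠ y := fun h => hz (Fin.ext (by exact_mod_cast h))
      have hiff : (z : ℤ) < a i + 1 ↔ (z : ℤ) < a i := by omega
      simp [diagramInd, hz, hiff]
  · simp [diagramInd, hi]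

theorem diagramInd_aPlus_add_aMinus (a : Fin m → ℤ) (i : ℕ) (hi : i + 1 < m) :
    diagramInd (aPlus a i hi) + diagramInd (aMinus a i hi) = diagramInd a +
      diagramInd a ∘ Prod.map (Equiv.swap (⟨i, by omega⟩ : Fin m) ⟨i + 1, hi⟩) id := by
  have hne : (⟨i, by omega⟩ : Fin m) ≠ ⟨i + 1, hi⟩ := by simp [Fin.ext_iff]
  funext ⟨j, y⟩
  by_cases h1 : j = ⟨i, by omega⟩
  · subst h1
    simp [diagramInd, aPlus, aMinus, hne]
  · by_cases h2 : j = ⟨i + 1, hi⟩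
    · subst h2
      simp [diagramInd, aPlus, aMinus, hne.symm, add_comm]
    · simp [diagramInd, aPlus, aMinus, h1, h2, Equiv.swap_apply_of_ne_of_ne h1 h2]

theorem memA.update_add_one {a : Fin m → ℤ} (ha : memA m a) {j : Fin m} (hj : a j < m)
    (hlt : ∀ i < j, a j < a i) : memA m (Function.update a j (a j + 1)) := by
  refine ⟨fun k => ?_, fun k => ?_, fun k₁ k₂ hk => ?_⟩
  · have := ha.1 k
    by_cases h : k = j
    · subst h
      simp only [Function.update_self]
      omega
    · simpa [h] using this
  · have := ha.2.1 k
    by_cases h : k = j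
    · subst h
      simp only [Function.update_self]
      omega
    · simpa [h] using this
  · have h12 := ha.2.2 hk
    by_cases h1 : k₁ = j
    · by_cases h2 : k₂ = j
      · rw [h1, h2]
      · rw [h1] at h12 ⊢
        simp only [Function.update_self, Function.update_of_ne h2]
        omega
    · by_cases h2 : k₂ = j
      · rw [h2] at hk ⊢
        have := hlt k₁ (lt_of_le_of_ne hk h1)
        simp only [Function.update_self, Function.update_of_ne h1]
        omega
      · simpa [h1, h2] using h12

theorem memA.aPlus {a : Fin m → ℤ} (ha : memA m a) (i : ℕ) (hi : i + 1 < m) :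
    memA m (aPlus a i hi) := by
  have hcases : ∀ k, _root_.aPlus a i hi k = a (if k = ⟨i + 1, hi⟩ then ⟨i, by omega⟩ else k) := by
    intro k
    by_cases h : k = ⟨i + 1, hi⟩ <;> simp [_root_.aPlus, h]
  refine ⟨fun k => ?_, fun k => ?_, fun k₁ k₂ hk => ?_⟩
  · rw [hcases]; exact ha.1 _
  · rw [hcases]; exact ha.2.1 _
  · rw [hcases, hcases]
    refine ha.2.2 ?_
    split_ifs <;> simp_all only [Fin.le_def, Fin.ext_iff] <;> omega

theorem memA.aMinus {a : Fin m → ℤ} (ha : memA m a) (i : ℕ) (hi : i + 1 < m) :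
    memA m (aMinus a i hi) := by
  have hcases : ∀ k, _root_.aMinus a i hi k = a (if k = ⟨i, by omega⟩ then ⟨i + 1, hi⟩ else k) := by
    intro k
    by_cases h : k = ⟨i, by omega⟩ <;> simp [_root_.aMinus, h]
  refine ⟨fun k => ?_, fun k => ?_, fun k₁ k₂ hk => ?_⟩
  · rw [hcases]; exact ha.1 _
  · rw [hcases]; exact ha.2.1 _
  · rw [hcases, hcases]
    refine ha.2.2 ?_
    split_ifs <;> simp_all only [Fin.le_def, Fin.ext_iff] <;> omega

theorem finite_setOf_memA (m n : ℕ) : {a : Fin n → Fin m → ℤ | ∀ l, memA m (a l)}.Finite :=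
  (Set.finite_Icc (fun _ _ => 0) fun _ _ => (m : ℤ)).subset fun _ ha =>
    ⟨fun l j => (ha l).1 j, fun l j => (ha l).2.1 j⟩

/-- A real function on families from `A(m)` attains its maximum at a family that is maximal
among the maximizers for the pointwise order. -/
theorem exists_maximal_maximizer {n : ℕ} (Z : (Fin n → Fin m → ℤ) → ℝ)
    (hne : {a : Fin n → Fin m → ℤ | ∀ l, memA m (a l)}.Nonempty) :
    ∃ a : Fin n → Fin m → ℤ, (∀ l, memA m (a l)) ∧
      (∀ b : Fin n → Fin m → ℤ, (∀ l, memA m (b l)) → Z b ≤ Z a) ∧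
      ∀ b : Fin n → Fin m → ℤ, (∀ l, memA m (b l)) → a < b → Z b < Z a := by
  have hfin := finite_setOf_memA m n
  obtain ⟨c, hc, hcmax⟩ := Set.exists_max_image _ Z hfin hne
  obtain ⟨a, ha⟩ := (hfin.subset (Set.sep_subset _ fun b => Z b = Z c)).exists_maximal ⟨c, hc, rfl⟩
  refine ⟨a, ha.prop.1, fun b hb => ha.prop.2 ▸ hcmax b hb, fun b hb hab => ?_⟩
  refine lt_of_le_of_ne (ha.prop.2 ▸ hcmax b hb) fun h => ?_
  exact ha.not_gt ⟨hb, h.trans ha.prop.2⟩ hab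

theorem diagramInd_comp_update {n : ℕ} (a : Fin n → Fin m → ℤ) (l : Fin n) (b : Fin m → ℤ) :
    (fun k => diagramInd (Function.update a l b k)) =
      Function.update (fun k => diagramInd (a k)) l (diagramInd b) := by
  funext k
  by_cases h : k = l
  · subst h
    simp
  · simp [h]

theorem memA_update {n : ℕ} {a : Fin n → Fin m → ℤ} (ha : ∀ l, memA m (a l)) {l : Fin n}
    {b : Fin m → ℤ} (hb : memA m b) (k : Fin n) : memA m (Function.update a l b k) := by
  by_cases h : k = l
  · subst h
    simpa using hb
  · simpa [h] using ha k

/-- Adding to one diagram a cell that is missing from another one does not decrease the cycle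
sum, provided shorter cycle sums are nonpositive. -/
theorem cycleSum_le_update_add_one {n : ℕ}
    (hneg : ∀ k ≤ n, 0 < k → ∀ a : Fin k → Fin m → ℤ, (∀ l, memA m (a l)) →
      cycleSum (gridMean m) (fun l => diagramInd (a l)) ≤ 0)
    {a : Fin (n + 1) → Fin m → ℤ} (ha : ∀ l, memA m (a l)) {l k : Fin (n + 1)} (hkl : k ≠ l)
    {j : Fin m} (hj : a l j < m) (hk : a k j ≤ a l j) :
    cycleSum (gridMean m) (fun l => diagramInd (a l)) ≤ cycleSum (gridMean m)
      (fun i => diagramInd (Function.update a l (Function.update (a l) j (a l j + 1)) i)) := by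
  have h0 := (ha l).1 j
  have hy : (((⟨(a l j).toNat, by omega⟩ : Fin m) : ℕ) : ℤ) = a l j := by simp [h0]
  rw [diagramInd_comp_update, diagramInd_update_add_one hy, cycleSum_update_add,
    cycleSum_update _ _ l (Pi.single _ _), cycleSum_cons_single, Function.update_eq_self]
  refine le_add_of_nonneg_right (mul_nonneg_of_nonpos_of_nonpos ?_ ?_)
  · exact neg_nonpos.2 (gridMean_nonneg fun x => by
      rw [Pi.single_apply]
      split_ifs <;> simp)
  · refine cycleSum_sub_proj_nonpos (C := {f | ∃ b, memA m b ∧ diagramInd b = f}) ?_ ?_ ?_ ?_ _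
      (fun i => ⟨_, ha _, rfl⟩) ?_
    · rintro _ ⟨b, hb, rfl⟩ _ ⟨c, hc, rfl⟩
      exact ⟨_, hb.prodMin hc, (diagramInd_mul b c).symm⟩
    · rintro _ ⟨b, -, rfl⟩
      exact diagramInd_eq_zero_or_one b _
    · rintro _ ⟨b, -, rfl⟩
      exact gridMean_le_one (diagramInd_le_one b)
    · intro k hkn hk0 G hG
      choose b hb hbG using hG
      rw [← funext hbG]
      exact hneg k hkn hk0 b hb
    · have hne : Equiv.swap 0 l k ≠ 0 := by
        rw [Ne, Equiv.swap_apply_eq_iff, Equiv.swap_apply_left]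
        exact hkl
      obtain ⟨r, hr⟩ := Fin.exists_succ_eq.2 hne
      refine ⟨r, ?_⟩
      simp only [hr, Equiv.swap_apply_self, diagramInd, hy]
      exact if_neg hk.not_gt

/-- If all other diagrams have equal columns `i` and `i + 1`, then the cycle sum at `a l` is the
average of its values at `a⁺` and `a⁻`. -/
theorem cycleSum_aPlus_add_aMinus {n : ℕ} (a : Fin n → Fin m → ℤ) (l : Fin n) (i : ℕ)
    (hi : i + 1 < m) (h : ∀ k ≠ l, a k ⟨i, by omega⟩ = a k ⟨i + 1, hi⟩) :
    cycleSum (gridMean m) (fun k => diagramInd (Function.update a l (aPlus (a l) i hi) k)) +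
      cycleSum (gridMean m) (fun k => diagramInd (Function.update a l (aMinus (a l) i hi) k)) =
      2 * cycleSum (gridMean m) (fun k => diagramInd (a k)) := by
  set s : Fin m × Fin m → Fin m × Fin m :=
    Prod.map (Equiv.swap (⟨i, by omega⟩ : Fin m) ⟨i + 1, hi⟩) id with hs
  have hinv : ∀ f, gridMean m (f ∘ s) = gridMean m f := fun f =>
    gridMean_comp_equiv ((Equiv.swap (⟨i, by omega⟩ : Fin m) ⟨i + 1, hi⟩).prodCongr
      (Equiv.refl _)) f
  have hswap : Function.update (fun k => diagramInd (a k)) l (diagramInd (a l) ∘ s) =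
      fun k => diagramInd (a k) ∘ s := by
    funext k
    by_cases hk : k = l
    · subst hk
      simp
    · rw [Function.update_of_ne hk]
      funext ⟨j, y⟩
      by_cases h1 : j = ⟨i, by omega⟩
      · subst h1
        simp [hs, diagramInd, h k hk]
      · by_cases h2 : j = ⟨i + 1, hi⟩
        · subst h2
          simp [hs, diagramInd, h k hk]
        · simp [hs, diagramInd, Equiv.swap_apply_of_ne_of_ne h1 h2]
  rw [diagramInd_comp_update, diagramInd_comp_update, ← cycleSum_update_add,
    diagramInd_aPlus_add_aMinus, cycleSum_update_add, ← hs, hswap,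
    cycleSum_comp_of_invariant _ s hinv, Function.update_eq_self, two_mul]

theorem cycleSum_cons_one {Ω : Type*} {n : ℕ} {L : (Ω → ℝ) →ₗ[ℝ] ℝ} (hL : L 1 = 1)
    (F : Fin (n + 1) → Ω → ℝ) :
    cycleSum L (Fin.cons 1 F : Fin (n + 2) → Ω → ℝ) = n * cycleSum L F := by
  simp only [cycleSum_cons, hL, mul_one, Function.update_eq_self, Finset.sum_const,
    Finset.card_univ, Fintype.card_fin, nsmul_eq_mul]
  push_cast
  ring

/-- In a maximal maximizer every corner outside one diagram lies in all others, and every diagram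
has all its columns equal. -/
theorem corners_and_columns_of_maximal {n : ℕ} {a : Fin (n + 1) → Fin m → ℤ} (ha : ∀ l, memA m (a l))
    (hneg : ∀ k ≤ n, 0 < k → ∀ a : Fin k → Fin m → ℤ, (∀ l, memA m (a l)) →
      cycleSum (gridMean m) (fun l => diagramInd (a l)) ≤ 0)
    (hmax : ∀ b : Fin (n + 1) → Fin m → ℤ, (∀ l, memA m (b l)) →
      cycleSum (gridMean m) (fun l => diagramInd (b l)) ≤
        cycleSum (gridMean m) (fun l => diagramInd (a l)))
    (hlt : ∀ b : Fin (n + 1) → Fin m → ℤ, (∀ l, memA m (b l)) → a < b →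
      cycleSum (gridMean m) (fun l => diagramInd (b l)) <
        cycleSum (gridMean m) (fun l => diagramInd (a l))) :
    (∀ l k, k ≠ l → ∀ j, a l j < m → (∀ i < j, a l j < a l i) → a l j < a k j) ∧
      ∀ l (i : ℕ) (hi : i + 1 < m), a l ⟨i, by omega⟩ = a l ⟨i + 1, hi⟩ := by
  have hcorner : ∀ l k, k ≠ l → ∀ j, a l j < m → (∀ i < j, a l j < a l i) → a l j < a k j := by
    intro l k hkl j hj hji
    by_contra! hk
    refine (cycleSum_le_update_add_one hneg ha hkl hj hk).not_gt (hlt _ (memA_update ha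
      ((ha l).update_add_one hj hji)) ?_)
    rw [lt_update_self_iff, lt_update_self_iff]
    exact lt_add_one _
  refine ⟨hcorner, fun l i hi => ?_⟩
  have hle : ∀ k, a k ⟨i + 1, hi⟩ ≤ a k ⟨i, by omega⟩ := fun k =>
    (ha k).2.2 (by simp [Fin.le_def])
  have hcol : ∀ l k, k ≠ l → a l ⟨i + 1, hi⟩ < a l ⟨i, by omega⟩ →
      a l ⟨i + 1, hi⟩ < a k ⟨i + 1, hi⟩ := fun l k hkl hsep =>
    hcorner l k hkl _ (hsep.trans_le ((ha l).2.1 _)) fun j hj =>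
      hsep.trans_le ((ha l).2.2 (by simp only [Fin.lt_def, Fin.le_def] at hj ⊢; omega))
  by_contra hne
  have hsep : a l ⟨i + 1, hi⟩ < a l ⟨i, by omega⟩ := lt_of_le_of_ne (hle l) (Ne.symm hne)
  have hothers : ∀ k ≠ l, a k ⟨i, by omega⟩ = a k ⟨i + 1, hi⟩ := by
    intro k hkl
    by_contra hk
    exact lt_asymm (hcol l k hkl hsep) (hcol k l hkl.symm (lt_of_le_of_ne (hle k) (Ne.symm hk)))
  have havg := cycleSum_aPlus_add_aMinus a l i hi hothers
  have hplus := hlt _ (memA_update (l := l) ha ((ha l).aPlus i hi)) (by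
    rw [lt_update_self_iff, aPlus, lt_update_self_iff]
    exact hsep)
  have hminus := hmax _ (memA_update (l := l) ha ((ha l).aMinus i hi))
  linarith

theorem cycleSum_diagramInd_nonpos (hm : 1 ≤ m) {n : ℕ} (hn : 0 < n) (a : Fin n → Fin m → ℤ)
    (ha : ∀ l, memA m (a l)) : cycleSum (gridMean m) (fun l => diagramInd (a l)) ≤ 0 := by
  induction n using Nat.strong_induction_on with
  | _ n ih =>
  match n, hn with
  | 1, _ =>
    rw [cycleSum_succ, cycleSum_fin_zero]
    simpa using gridMean_nonneg (diagramInd_nonneg (a 0))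
  | n + 2, _ =>
    obtain ⟨b, hb, hmax, hlt⟩ := exists_maximal_maximizer
      (fun a : Fin (n + 2) → Fin m → ℤ => cycleSum (gridMean m) fun l => diagramInd (a l)) ⟨a, ha⟩
    refine (hmax a ha).trans ?_
    obtain ⟨hcorner, hcol⟩ := corners_and_columns_of_maximal hb
      (fun k hk hk0 c hc => ih k (by omega) hk0 c hc) hmax hlt
    have hconst : ∀ l (i : ℕ) (hi : i < m), b l ⟨i, hi⟩ = b l ⟨0, hm⟩ := by
      intro l i
      induction i with
      | zero => exact fun _ => rfl
      | succ i ihi => exact fun hi => (hcol l i hi).symm.trans (ihi _)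
    obtain ⟨l, hl⟩ : ∃ l, b l ⟨0, hm⟩ = m := by
      by_contra! hne
      have hlow : ∀ l k, k ≠ l → b l ⟨0, hm⟩ < b k ⟨0, hm⟩ := fun l k hkl =>
        hcorner l k hkl _ (lt_of_le_of_ne ((hb l).2.1 _) (hne l)) fun i hi => by
          simp [Fin.lt_def] at hi
      exact lt_asymm (hlow 0 1 (by simp)) (hlow 1 0 (by simp))
    have hone : diagramInd (b l) = 1 := by
      funext ⟨j, y⟩
      have hj : b l j = m := (hconst l j j.2).trans hl
      simp [diagramInd, hj]
    have hmean : gridMean m 1 = 1 := by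
      have : (m : ℝ) ≠ 0 := by positivity
      simp [gridMean_apply, sq, this]
    have hupd : (fun k => diagramInd (b k)) =
        Function.update (fun k => diagramInd (b k)) l 1 := by
      rw [← hone, Function.update_eq_self]
    rw [hupd, cycleSum_update, cycleSum_cons_one hmean]
    exact mul_nonpos_of_nonneg_of_nonpos (by positivity)
      (ih (n + 1) (by omega) n.succ_pos (fun i => b (Equiv.swap 0 l i.succ)) fun i => hb _)

end Diagrams

/-- For all `a¹,…,aⁿ ∈ A(m)` we have `E_n(a¹,…,aⁿ) ≥ 0`. -/
theorem stmt_16 (m : ℕ) (hm : 1 ≤ m) (n : ℕ) (hn : 1 ≤ n)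
    (a : Fin n → Fin m → ℤ) (ha : ∀ l, memA m (a l)) :
    0 ≤ EnSeq a := by
  rw [EnSeq_eq_neg_cycleSum hn ha]
  exact neg_nonneg.2 (cycleSum_diagramInd_nonpos hm hn a ha)
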